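/- Under the stated Bessel transformation property and the Hecke relations, for every integer l ≥ 0, setting M = (−p·w_p)^l · p^{−4l}, one has: B(h(l,0)·t₁) = −M/p, B(h(l,0)·t₂) = M/p², B(h(l,0)·t₅) = M, and B(h(l,0)·t₇) = −M·Λ_p((b/2)·1₂ + ξ)/p³ (here (b/2)·1₂ + ξ is the matrix (b, c; −a, 0) ∈ T(ℤ_p), corresponding to (b+√−d)/2). -/

import Mathlib

open Matrix

noncomputable section

variable (p : ℕ) [Fact p.Prime]

/-- The 4×4 symplectic similitude matrix `J`. -/
def Jmat : Matrix (Fin 4) (Fin 4) ℚ_[p] :=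
  !![0,0,1,0; 0,0,0,1; -1,0,0,0; 0,-1,0,0]

/-- `GSp₄(ℚ_p)`. -/
def GSp4 : Set (Matrix (Fin 4) (Fin 4) ℚ_[p]) :=
  {g | IsUnit g.det ∧ ∃ μ : ℚ_[p]ˣ, gᵀ * Jmat p * g = (μ : ℚ_[p]) • Jmat p}

/-- `K_p = GSp₄(ℤ_p)`, viewed inside `GSp₄(ℚ_p)`. -/
def Kp : Set (Matrix (Fin 4) (Fin 4) ℚ_[p]) :=
  {g | g ∈ GSp4 p ∧ (∀ i j, ‖g i j‖ ≤ 1) ∧ ‖g.det‖ = 1}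

/-- The Iwahori subgroup `I_p`: elements of `K_p` whose reduction mod `p` has zero
entries at positions (1,2), (3,1), (3,2), (4,1), (4,2), (4,3) (0-indexed below). -/
def Ip : Set (Matrix (Fin 4) (Fin 4) ℚ_[p]) :=
  {g | g ∈ Kp p ∧ ‖g 0 1‖ < 1 ∧ ‖g 2 0‖ < 1 ∧ ‖g 2 1‖ < 1 ∧
      ‖g 3 0‖ < 1 ∧ ‖g 3 1‖ < 1 ∧ ‖g 3 2‖ < 1}

/-- The matrix `U_x` for `x = (n,q,r)`. -/
def Umat (n q r : ℚ_[p]) : Matrix (Fin 4) (Fin 4) ℚ_[p] :=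
  !![1,0,n,q; 0,1,q,r; 0,0,1,0; 0,0,0,1]

/-- The matrix `Z_y` for `y ∈ ℤ_p`. -/
def Zmat (y : ℚ_[p]) : Matrix (Fin 4) (Fin 4) ℚ_[p] :=
  !![1,y,0,0; 0,1,0,0; 0,0,1,0; 0,0,-y,1]

/-- The matrix `Z_∞`. -/
def Zinf : Matrix (Fin 4) (Fin 4) ℚ_[p] :=
  !![0,1,0,0; 1,0,0,0; 0,0,0,1; 0,0,1,0]

/-- `Z_v` for `v ∈ V = Y ∪ {∞}`, where `Y = {0,…,p−1}` is modelled by `Fin p`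
and `∞` by `none`. -/
def ZV : Option (Fin p) → Matrix (Fin 4) (Fin 4) ℚ_[p]
  | some y => Zmat p (y.val : ℚ_[p])
  | none => Zinf p

/-- Class A matrices `A_x^y = U_x · J · Z_y`. -/
def Amat (x : Fin p × Fin p × Fin p) (v : Option (Fin p)) : Matrix (Fin 4) (Fin 4) ℚ_[p] :=
  Umat p (x.1.val : ℚ_[p]) (x.2.1.val : ℚ_[p]) (x.2.2.val : ℚ_[p]) * Jmat p * ZV p v

/-- Class B matrices `B_x^y = J · U_x · J · Z_y`. -/
def Bmat (x : Fin p × Fin p × Fin p) (v : Option (Fin p)) : Matrix (Fin 4) (Fin 4) ℚ_[p] :=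
  Jmat p * Umat p (x.1.val : ℚ_[p]) (x.2.1.val : ℚ_[p]) (x.2.2.val : ℚ_[p]) * Jmat p * ZV p v

/-- Assemble a 4×4 matrix from 2×2 blocks. -/
def blk (A B C D : Matrix (Fin 2) (Fin 2) ℚ_[p]) : Matrix (Fin 4) (Fin 4) ℚ_[p] :=
  Matrix.reindex finSumFinEquiv finSumFinEquiv (fromBlocks A B C D)

variable (a b c : ℚ_[p])

/-- The matrix `S = (a, b/2; b/2, c)`. -/
def Smat : Matrix (Fin 2) (Fin 2) ℚ_[p] := !![a, b/2; b/2, c]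

/-- The matrix `ξ = (b/2, c; −a, −b/2)`. -/
def xiS : Matrix (Fin 2) (Fin 2) ℚ_[p] := !![b/2, c; -a, -b/2]

/-- The torus `T(ℚ_p) = {g ∈ GL₂(ℚ_p) : gᵀSg = det(g)·S}`. -/
def Tgrp : Set (Matrix (Fin 2) (Fin 2) ℚ_[p]) :=
  {g | IsUnit g.det ∧ gᵀ * Smat p a b c * g = g.det • Smat p a b c}

/-- The embedding `g ↦ diag(g, det(g)·(g⁻¹)ᵀ)` of `GL₂` into `GSp₄`. -/
def emb (g : Matrix (Fin 2) (Fin 2) ℚ_[p]) : Matrix (Fin 4) (Fin 4) ℚ_[p] :=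
  blk p g 0 0 (g.det • (g⁻¹)ᵀ)

/-- The unipotent group `U(ℚ_p)`. -/
def Ugrp : Set (Matrix (Fin 4) (Fin 4) ℚ_[p]) :=
  {u | ∃ X : Matrix (Fin 2) (Fin 2) ℚ_[p], Xᵀ = X ∧ u = blk p 1 X 0 1}

/-- The Bessel group `R(ℚ_p) = T(ℚ_p)·U(ℚ_p)` inside `GSp₄(ℚ_p)`. -/
def Rgrp : Set (Matrix (Fin 4) (Fin 4) ℚ_[p]) :=
  {r | ∃ t ∈ Tgrp p a b c, ∃ u ∈ Ugrp p, r = emb p t * u}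

/-- `h(l,m) = diag(p^{2m+l}, p^{m+l}, 1, p^m)`. -/
def hmat (l : ℤ) (m : ℕ) : Matrix (Fin 4) (Fin 4) ℚ_[p] :=
  diagonal ![(p : ℚ_[p]) ^ (2 * (m : ℤ) + l), (p : ℚ_[p]) ^ ((m : ℤ) + l), 1, (p : ℚ_[p]) ^ (m : ℤ)]

/-- `(l,m)`-equivalence: `f ~ g` iff `r·h(l,m)·f·k = h(l,m)·g` for some
`r ∈ R(ℚ_p)`, `k ∈ I_p`. -/
def LMEquiv (l : ℤ) (m : ℕ) (f g : Matrix (Fin 4) (Fin 4) ℚ_[p]) : Prop :=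
  ∃ r ∈ Rgrp p a b c, ∃ k ∈ Ip p, r * hmat p l m * f * k = hmat p l m * g

/-- `t₁ = B_{(1,0,0)}^0`. -/
def t1 : Matrix (Fin 4) (Fin 4) ℚ_[p] := Jmat p * Umat p 1 0 0 * Jmat p * Zmat p 0
/-- `t₂ = B_{(1,0,0)}^∞`. -/
def t2 : Matrix (Fin 4) (Fin 4) ℚ_[p] := Jmat p * Umat p 1 0 0 * Jmat p * Zinf p
/-- `t₃ = B_{(0,0,1)}^0`. -/
def t3 : Matrix (Fin 4) (Fin 4) ℚ_[p] := Jmat p * Umat p 0 0 1 * Jmat p * Zmat p 0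
/-- `t₄ = B_{(0,0,1)}^∞`. -/
def t4 : Matrix (Fin 4) (Fin 4) ℚ_[p] := Jmat p * Umat p 0 0 1 * Jmat p * Zinf p
/-- `t₅ = B_{(0,0,0)}^0`. -/
def t5 : Matrix (Fin 4) (Fin 4) ℚ_[p] := Jmat p * Umat p 0 0 0 * Jmat p * Zmat p 0
/-- `t₆ = B_{(0,0,0)}^∞`. -/
def t6 : Matrix (Fin 4) (Fin 4) ℚ_[p] := Jmat p * Umat p 0 0 0 * Jmat p * Zinf p
/-- `t₇ = A_{(0,0,0)}^0`. -/
def t7 : Matrix (Fin 4) (Fin 4) ℚ_[p] := Umat p 0 0 0 * Jmat p * Zmat p 0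
/-- `t₈ = A_{(0,0,0)}^∞`. -/
def t8 : Matrix (Fin 4) (Fin 4) ℚ_[p] := Umat p 0 0 0 * Jmat p * Zinf p

/-- `T_m`: `{t₁,…,t₈}` if `m > 0`, and `{t₁, t₂, t₅, t₇}` if `m = 0`. -/
def TsetM (m : ℕ) : Set (Matrix (Fin 4) (Fin 4) ℚ_[p]) :=
  if m = 0 then {t1 p, t2 p, t5 p, t7 p}
  else {t1 p, t2 p, t3 p, t4 p, t5 p, t6 p, t7 p, t8 p}

/-- `GL₂(ℤ_p)` viewed inside `GL₂(ℚ_p)`: integral entries and unit determinant. -/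
def GL2Z : Set (Matrix (Fin 2) (Fin 2) ℚ_[p]) :=
  {g | (∀ i j, ‖g i j‖ ≤ 1) ∧ ‖g.det‖ = 1}

/-- The Atkin–Lehner element `η_p`. -/
def etamat : Matrix (Fin 4) (Fin 4) ℚ_[p] :=
  !![0,0,0,1; 0,0,1,0; 0,(p:ℚ_[p]),0,0; (p:ℚ_[p]),0,0,0]

/-- `R_y` for `y ∈ V`: `R_y = (U_{(y,0,0)})ᵀ` for `y ∈ Y` and the given matrix for `y = ∞`. -/
def RV : Option (Fin p) → Matrix (Fin 4) (Fin 4) ℚ_[p]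
  | some y => (Umat p (y.val : ℚ_[p]) 0 0)ᵀ
  | none => !![0,0,-1,0; 0,-1,0,0; -1,0,0,0; 0,0,0,1]

variable {p}

lemma mem_Ip_of_similitude {k : Matrix (Fin 4) (Fin 4) ℚ_[p]} {μ : ℚ_[p]} (hμ : ‖μ‖ = 1)
    (hk : kᵀ * Jmat p * k = μ • Jmat p) (hint : ∀ i j, ‖k i j‖ ≤ 1)
    (h01 : k 0 1 = 0) (h20 : k 2 0 = 0) (h21 : k 2 1 = 0)
    (h30 : k 3 0 = 0) (h31 : k 3 1 = 0) (h32 : k 3 2 = 0) : k ∈ Ip p := by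
  have hμ0 : μ ≠ 0 := norm_ne_zero_iff.mp (by rw [hμ]; exact one_ne_zero)
  have hJ : (Jmat p).det = 1 := by
    simp [Jmat, det_succ_row_zero, Fin.sum_univ_succ, Fin.succAbove]
  have hdet : k.det ^ 2 = μ ^ 4 := by
    have h := congrArg Matrix.det hk
    simp only [det_mul, det_transpose, det_smul, hJ, Fintype.card_fin, mul_one] at h
    rw [sq, h]
  have hnorm : ‖k.det‖ = 1 := by
    have h := congrArg norm hdet
    rw [norm_pow, norm_pow, hμ, one_pow] at h
    exact (pow_eq_one_iff_of_nonneg (norm_nonneg _) two_ne_zero).mp h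
  have hne : k.det ≠ 0 := norm_ne_zero_iff.mp (by rw [hnorm]; exact one_ne_zero)
  exact ⟨⟨⟨hne.isUnit, Units.mk0 μ hμ0, hk⟩, hint, hnorm⟩, by simp [*]⟩

lemma one_mem_Ip : (1 : Matrix (Fin 4) (Fin 4) ℚ_[p]) ∈ Ip p := by
  refine mem_Ip_of_similitude (μ := 1) (by simp) (by simp) (fun i j ↦ ?_) ?_ ?_ ?_ ?_ ?_ ?_
  · rw [Matrix.one_apply]; split_ifs <;> simp
  all_goals simp

lemma diagonal_mem_Ip {x y z t : ℚ_[p]} (hx : ‖x‖ = 1) (hy : ‖y‖ = 1) (hz : ‖z‖ = 1)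
    (ht : ‖t‖ = 1) (h : x * z = y * t) :
    !![x,0,0,0; 0,y,0,0; 0,0,z,0; 0,0,0,t] ∈ Ip p := by
  refine mem_Ip_of_similitude (μ := x * z) (by simp [hx, hz]) ?_ ?_ ?_ ?_ ?_ ?_ ?_ ?_
  · ext i j
    fin_cases i <;> fin_cases j <;>
      simp [Jmat, Matrix.mul_apply, Fin.sum_univ_four] <;> grind
  · intro i j
    fin_cases i <;> fin_cases j <;> simp [hx, hy, hz, ht]
  all_goals simp

lemma norm_natCast_eq_one {y : ℕ} (h0 : y ≠ 0) (hy : y < p) : ‖(y : ℚ_[p])‖ = 1 :=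
  Padic.norm_natCast_eq_one_iff.mpr (Nat.coprime_of_lt_prime h0 hy Fact.out)

lemma transpose_Umat_eq {y : ℚ_[p]} (hy : y ≠ 0) :
    (Umat p y 0 0)ᵀ = Umat p y⁻¹ 0 0 * RV p none *
      !![-y,0,-1,0; 0,-1,0,0; 0,0,y⁻¹,0; 0,0,0,1] := by
  ext i j
  fin_cases i <;> fin_cases j <;>
    simp [Umat, RV, Matrix.mul_apply, Fin.sum_univ_four, hy]

lemma iwahori_transpose_Umat {y : ℚ_[p]} (hy : ‖y‖ = 1) :
    !![-y,0,-1,0; 0,-1,0,0; 0,0,y⁻¹,0; 0,0,0,1] ∈ Ip p := by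
  have hy0 : y ≠ 0 := norm_ne_zero_iff.mp (by rw [hy]; exact one_ne_zero)
  refine mem_Ip_of_similitude (μ := -1) (by simp) ?_ ?_ ?_ ?_ ?_ ?_ ?_ ?_
  · ext i j
    fin_cases i <;> fin_cases j <;>
      simp [Jmat, Matrix.mul_apply, Fin.sum_univ_four, hy0]
  · intro i j
    fin_cases i <;> fin_cases j <;> simp [hy]
  all_goals simp

lemma Zmat_eq {y : ℚ_[p]} (hy : y ≠ 0) :
    Zmat p y = (Zmat p y⁻¹)ᵀ * Zinf p *
      !![-y⁻¹,0,0,0; 1,y,0,0; 0,0,-y,1; 0,0,0,y⁻¹] := by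
  ext i j
  fin_cases i <;> fin_cases j <;>
    simp [Zmat, Zinf, Matrix.mul_apply, Fin.sum_univ_four, hy]

lemma iwahori_Zmat {y : ℚ_[p]} (hy : ‖y‖ = 1) :
    !![-y⁻¹,0,0,0; 1,y,0,0; 0,0,-y,1; 0,0,0,y⁻¹] ∈ Ip p := by
  have hy0 : y ≠ 0 := norm_ne_zero_iff.mp (by rw [hy]; exact one_ne_zero)
  refine mem_Ip_of_similitude (μ := 1) (by simp) ?_ ?_ ?_ ?_ ?_ ?_ ?_ ?_
  · ext i j
    fin_cases i <;> fin_cases j <;>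
      simp [Jmat, Matrix.mul_apply, Fin.sum_univ_four, hy0]
  · intro i j
    fin_cases i <;> fin_cases j <;> simp [hy]
  all_goals simp

section Hecke

variable {B : Matrix (Fin 4) (Fin 4) ℚ_[p] → ℂ}

/-- A sum over `V = Y ∪ {∞}` collapses when all terms except the one at `0` agree with the one
at `∞`. -/
lemma sum_option_fin_eq {f : Option (Fin p) → ℂ} {z : ℂ}
    (h0 : ∀ y : Fin p, y.val = 0 → f (some y) = z)
    (h : ∀ y : Fin p, y.val ≠ 0 → f (some y) = f none) :
    ∑ v, f v = z + p * f none := by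
  have hp : 0 < p := (Fact.out : p.Prime).pos
  have hsum : ∀ y : Fin p, f (some y) = f none + if y = ⟨0, hp⟩ then z - f none else 0 := by
    intro y
    by_cases hy : y = ⟨0, hp⟩
    · rw [if_pos hy, h0 y (by rw [hy])]
      ring
    · have : y.val ≠ 0 := fun h' ↦ hy (Fin.ext h')
      rw [if_neg hy, h y this, add_zero]
  rw [Fintype.sum_option, Finset.sum_congr rfl fun y _ ↦ hsum y, Finset.sum_add_distrib,
    Finset.sum_ite_eq' Finset.univ]
  simp
  ring

lemma hecke_R_relation (hK : ∀ g, ∀ k ∈ Ip p, B (g * k) = B g)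
    (hHR : ∀ g : Matrix (Fin 4) (Fin 4) ℚ_[p], ∑ v : Option (Fin p), B (g * RV p v) = 0)
    {g : Matrix (Fin 4) (Fin 4) ℚ_[p]}
    (hg : ∀ n : ℚ_[p], ‖n‖ ≤ 1 → ∀ x, B (g * (Umat p n 0 0 * x)) = B (g * x)) :
    B g + p * B (g * RV p none) = 0 := by
  rw [← hHR g]
  refine (sum_option_fin_eq (f := fun v ↦ B (g * RV p v)) (fun y hy ↦ ?_) fun y hy ↦ ?_).symm
  · have : RV p (some y) = 1 := by
      ext i j
      fin_cases i <;> fin_cases j <;> simp [RV, Umat, hy]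
    rw [this, mul_one]
  · have hn := norm_natCast_eq_one hy y.isLt
    have hy0 : (y.val : ℚ_[p]) ≠ 0 := by exact_mod_cast hy
    change B (g * (Umat p (y.val : ℚ_[p]) 0 0)ᵀ) = _
    rw [transpose_Umat_eq hy0, ← mul_assoc g, hK _ _ (iwahori_transpose_Umat hn)]
    exact hg _ (by simp [hn]) _

lemma hecke_Z_relation (hK : ∀ g, ∀ k ∈ Ip p, B (g * k) = B g)
    (hHZ : ∀ g : Matrix (Fin 4) (Fin 4) ℚ_[p], ∑ v : Option (Fin p), B (g * ZV p v) = 0)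
    {g : Matrix (Fin 4) (Fin 4) ℚ_[p]}
    (hg : ∀ n : ℚ_[p], ‖n‖ ≤ 1 → ∀ x, B (g * ((Zmat p n)ᵀ * x)) = B (g * x)) :
    B g + p * B (g * Zinf p) = 0 := by
  rw [← hHZ g]
  refine (sum_option_fin_eq (f := fun v ↦ B (g * ZV p v)) (fun y hy ↦ ?_) fun y hy ↦ ?_).symm
  · have : ZV p (some y) = 1 := by
      ext i j
      fin_cases i <;> fin_cases j <;> simp [ZV, Zmat, hy]
    rw [this, mul_one]
  · have hn := norm_natCast_eq_one hy y.isLt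
    have hy0 : (y.val : ℚ_[p]) ≠ 0 := by exact_mod_cast hy
    change B (g * Zmat p (y.val : ℚ_[p])) = _
    rw [Zmat_eq hy0, ← mul_assoc g, hK _ _ (iwahori_Zmat hn)]
    exact hg _ (by simp [hn]) _

/-- Values of `B` at the initial subwords of the reduced word `R_∞ Z_∞ R_∞`, when `h` carries the
integral unipotent elements into the kernel of `θ_p`. -/
lemma hecke_values_of_weyl_word (hK : ∀ g, ∀ k ∈ Ip p, B (g * k) = B g)
    (hHZ : ∀ g : Matrix (Fin 4) (Fin 4) ℚ_[p], ∑ v : Option (Fin p), B (g * ZV p v) = 0)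
    (hHR : ∀ g : Matrix (Fin 4) (Fin 4) ℚ_[p], ∑ v : Option (Fin p), B (g * RV p v) = 0)
    {h : Matrix (Fin 4) (Fin 4) ℚ_[p]}
    (hU : ∀ n q r : ℚ_[p], ‖n‖ ≤ 1 → ‖q‖ ≤ 1 → ‖r‖ ≤ 1 → ∀ x,
      B (h * (Umat p n q r * x)) = B (h * x)) :
    B (h * RV p none) = -B h / p ∧
    B (h * RV p none * Zinf p) = B h / p ^ 2 ∧
    B (h * RV p none * Zinf p * RV p none) = -B h / p ^ 3 := by
  have hp : (p : ℂ) ≠ 0 := by exact_mod_cast (Fact.out : p.Prime).ne_zero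
  have h1 : B h + p * B (h * RV p none) = 0 :=
    hecke_R_relation hK hHR fun n hn x ↦ hU n 0 0 hn (by simp) (by simp) x
  have h2 : B (h * RV p none) + p * B (h * RV p none * Zinf p) = 0 := by
    refine hecke_Z_relation hK hHZ fun n hn x ↦ ?_
    have : RV p none * (Zmat p n)ᵀ = Umat p 0 n 0 * RV p none := by
      ext i j
      fin_cases i <;> fin_cases j <;>
        simp [RV, Zmat, Umat, Matrix.mul_apply, Fin.sum_univ_four]
    rw [← mul_assoc, mul_assoc h, this, mul_assoc, mul_assoc, hU _ _ _ (by simp) hn (by simp),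
      mul_assoc]
  have h3 : B (h * RV p none * Zinf p) + p * B (h * RV p none * Zinf p * RV p none) = 0 := by
    refine hecke_R_relation hK hHR fun n hn x ↦ ?_
    have : RV p none * Zinf p * Umat p n 0 0 = Umat p 0 0 (-n) * (RV p none * Zinf p) := by
      ext i j
      fin_cases i <;> fin_cases j <;>
        simp [RV, Zinf, Umat, Matrix.mul_apply, Fin.sum_univ_four]
    rw [← mul_assoc, mul_assoc h, mul_assoc h, this, mul_assoc, mul_assoc,
      hU _ _ _ (by simp) (by simp) (by simpa using hn), ← mul_assoc h, ← mul_assoc h]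
  have e1 : B (h * RV p none) = -B h / p := by
    rw [eq_div_iff hp]; linear_combination h1
  have e2 : B (h * RV p none * Zinf p) = B h / p ^ 2 := by
    rw [e1] at h2; field_simp at h2 ⊢; linear_combination h2
  refine ⟨e1, e2, ?_⟩
  rw [e2] at h3; field_simp at h3 ⊢; linear_combination h3

end Hecke

lemma blk_one_zero_eq_Umat (n q r : ℚ_[p]) : blk p 1 !![n, q; q, r] 0 1 = Umat p n q r := by
  ext i j
  fin_cases i <;> fin_cases j <;> rfl

lemma emb_eq {x y z t : ℚ_[p]} (h : x * t - y * z ≠ 0) :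
    emb p !![x, y; z, t] = !![x,y,0,0; z,t,0,0; 0,0,t,-z; 0,0,-y,x] := by
  have hadj : (!![x, y; z, t].det • !![x, y; z, t]⁻¹ᵀ) = !![t, -z; -y, x] := by
    rw [Matrix.inv_def, transpose_smul, smul_smul, det_fin_two_of,
      Ring.mul_inverse_cancel _ h.isUnit, one_smul, adjugate_fin_two_of]
    ext i j
    fin_cases i <;> fin_cases j <;> rfl
  rw [emb, hadj]
  ext i j
  fin_cases i <;> fin_cases j <;> rfl

lemma emb_smul_one {z : ℚ_[p]} (hz : z ≠ 0) :
    emb p (z • (1 : Matrix (Fin 2) (Fin 2) ℚ_[p])) = z • 1 := by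
  have : z • (1 : Matrix (Fin 2) (Fin 2) ℚ_[p]) = !![z, 0; 0, z] := by
    ext i j
    fin_cases i <;> fin_cases j <;> simp
  rw [this, emb_eq (by simpa using hz)]
  ext i j
  fin_cases i <;> fin_cases j <;> simp

lemma smul_one_mem_Tgrp {z : ℚ_[p]} (hz : z ≠ 0) :
    z • (1 : Matrix (Fin 2) (Fin 2) ℚ_[p]) ∈ Tgrp p a b c := by
  refine ⟨by simp [hz], ?_⟩
  simp [smul_smul, sq]

lemma half_smul_one_add_xiS :
    (b / 2) • (1 : Matrix (Fin 2) (Fin 2) ℚ_[p]) + xiS p a b c = !![b, c; -a, 0] := by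
  ext i j
  fin_cases i <;> fin_cases j <;> simp [xiS] <;> ring

variable {a c}

lemma torus_generator_mem_Tgrp (ha : a ≠ 0) (hc : c ≠ 0) : !![b, c; -a, 0] ∈ Tgrp p a b c := by
  refine ⟨by simp [det_fin_two, ha, hc], ?_⟩
  ext i j
  fin_cases i <;> fin_cases j <;>
    simp [Smat, det_fin_two, Matrix.mul_apply, Fin.sum_univ_two] <;> ring

/-- The torus element `(b, c; -a, 0)` moves `J · Z_∞` to `J` modulo the Iwahori subgroup. -/
lemma emb_torus_generator_mul (ha : a ≠ 0) (hc : c ≠ 0) :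
    emb p !![b, c; -a, 0] * (Jmat p * Zinf p) *
      !![a⁻¹,0,0,0; b * a⁻¹ * c⁻¹,-c⁻¹,0,0; 0,0,c⁻¹,b * a⁻¹ * c⁻¹; 0,0,0,-a⁻¹] = Jmat p := by
  rw [emb_eq (by simp [ha, hc])]
  ext i j
  fin_cases i <;> fin_cases j <;>
    simp [Jmat, Zinf, Matrix.mul_apply, Fin.sum_univ_four, ha, hc] <;> field_simp <;> ring

lemma iwahori_torus_generator (ha : ‖a‖ = 1) (hb : ‖b‖ ≤ 1) (hc : ‖c‖ = 1) :
    !![a⁻¹,0,0,0; b * a⁻¹ * c⁻¹,-c⁻¹,0,0; 0,0,c⁻¹,b * a⁻¹ * c⁻¹; 0,0,0,-a⁻¹] ∈ Ip p := by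
  refine mem_Ip_of_similitude (μ := a⁻¹ * c⁻¹) (by simp [ha, hc]) ?_ ?_ ?_ ?_ ?_ ?_ ?_ ?_
  · ext i j
    fin_cases i <;> fin_cases j <;>
      simp [Jmat, Matrix.mul_apply, Fin.sum_univ_four] <;> ring
  · intro i j
    fin_cases i <;> fin_cases j <;> simp [ha, hb, hc]
  all_goals simp

lemma hmat_mul_Umat (l : ℤ) (n q r : ℚ_[p]) :
    hmat p l 0 * Umat p n q r =
      blk p 1 ((p : ℚ_[p]) ^ l • !![n, q; q, r]) 0 1 * hmat p l 0 := by
  have : (p : ℚ_[p]) ^ l • !![n, q; q, r] =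
      !![(p : ℚ_[p]) ^ l * n, (p : ℚ_[p]) ^ l * q; (p : ℚ_[p]) ^ l * q, (p : ℚ_[p]) ^ l * r] := by
    ext i j
    fin_cases i <;> fin_cases j <;> simp
  rw [this, blk_one_zero_eq_Umat]
  ext i j
  fin_cases i <;> fin_cases j <;>
    simp [hmat, Umat, Matrix.mul_apply, diagonal_apply]

lemma hmat_mul_emb (l : ℤ) {x y z t : ℚ_[p]} (h : x * t - y * z ≠ 0) :
    hmat p l 0 * emb p !![x, y; z, t] = emb p !![x, y; z, t] * hmat p l 0 := by
  rw [emb_eq h]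
  ext i j
  fin_cases i <;> fin_cases j <;>
    simp [hmat, Matrix.mul_apply, diagonal_apply, mul_comm]

lemma hmat_succ_mul_etamat (l : ℕ) :
    hmat p ((l + 1 : ℕ) : ℤ) 0 * etamat p =
      (p : ℚ_[p]) • (hmat p l 0 * RV p none * Zinf p * RV p none *
        !![-1,0,0,0; 0,1,0,0; 0,0,1,0; 0,0,0,-1]) := by
  ext i j
  fin_cases i <;> fin_cases j <;>
    simp [hmat, etamat, RV, Zinf, Matrix.mul_apply, Fin.sum_univ_four, diagonal_apply] <;>
    norm_cast <;> ring

lemma t1_eq : t1 p = Umat p (-1) 0 0 * (RV p none *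
    !![-1,0,1,0; 0,1,0,0; 0,0,1,0; 0,0,0,-1]) := by
  ext i j
  fin_cases i <;> fin_cases j <;>
    simp [t1, Jmat, Umat, Zmat, RV, Matrix.mul_apply, Fin.sum_univ_four]

lemma t2_eq : t2 p = Umat p (-1) 0 0 * (RV p none * Zinf p *
    !![1,0,0,0; 0,-1,0,1; 0,0,-1,0; 0,0,0,1]) := by
  ext i j
  fin_cases i <;> fin_cases j <;>
    simp [t2, Jmat, Umat, Zinf, RV, Matrix.mul_apply, Fin.sum_univ_four]

lemma t5_eq : t5 p = !![-1,0,0,0; 0,-1,0,0; 0,0,-1,0; 0,0,0,-1] := by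
  ext i j
  fin_cases i <;> fin_cases j <;>
    simp [t5, Jmat, Umat, Zmat, Matrix.mul_apply, Fin.sum_univ_four]

lemma t7_eq : t7 p = Jmat p := by
  ext i j
  fin_cases i <;> fin_cases j <;>
    simp [t7, Jmat, Umat, Zmat, Matrix.mul_apply, Fin.sum_univ_four]

lemma Jmat_mul_Zinf_eq : Jmat p * Zinf p = RV p none * Zinf p * RV p none *
    !![1,0,0,0; 0,-1,0,0; 0,0,1,0; 0,0,0,-1] := by
  ext i j
  fin_cases i <;> fin_cases j <;>
    simp [Jmat, Zinf, RV, Matrix.mul_apply, Fin.sum_univ_four]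

lemma iwahori_t1 : !![-1,0,1,0; 0,1,0,0; 0,0,1,0; 0,0,0,-1] ∈ Ip p := by
  refine mem_Ip_of_similitude (μ := -1) (by simp) ?_ ?_ ?_ ?_ ?_ ?_ ?_ ?_
  · ext i j
    fin_cases i <;> fin_cases j <;> simp [Jmat, Matrix.mul_apply, Fin.sum_univ_four]
  · intro i j
    fin_cases i <;> fin_cases j <;> simp
  all_goals simp

lemma iwahori_t2 : !![1,0,0,0; 0,-1,0,1; 0,0,-1,0; 0,0,0,1] ∈ Ip p := by
  refine mem_Ip_of_similitude (μ := -1) (by simp) ?_ ?_ ?_ ?_ ?_ ?_ ?_ ?_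
  · ext i j
    fin_cases i <;> fin_cases j <;> simp [Jmat, Matrix.mul_apply, Fin.sum_univ_four]
  · intro i j
    fin_cases i <;> fin_cases j <;> simp
  all_goals simp

lemma norm_trace_Smat_mul_le (l : ℕ) (ha : ‖a‖ ≤ 1) (hb : ‖b‖ ≤ 1) (hc : ‖c‖ ≤ 1) {n q r : ℚ_[p]}
    (hn : ‖n‖ ≤ 1) (hq : ‖q‖ ≤ 1) (hr : ‖r‖ ≤ 1) :
    ‖(Smat p a b c * ((p : ℚ_[p]) ^ (l : ℤ) • !![n, q; q, r])).trace‖ ≤ 1 := by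
  obtain ⟨a, rfl⟩ : ∃ z : ℤ_[p], (z : ℚ_[p]) = a := ⟨⟨a, ha⟩, rfl⟩
  obtain ⟨b, rfl⟩ : ∃ z : ℤ_[p], (z : ℚ_[p]) = b := ⟨⟨b, hb⟩, rfl⟩
  obtain ⟨c, rfl⟩ : ∃ z : ℤ_[p], (z : ℚ_[p]) = c := ⟨⟨c, hc⟩, rfl⟩
  obtain ⟨n, rfl⟩ : ∃ z : ℤ_[p], (z : ℚ_[p]) = n := ⟨⟨n, hn⟩, rfl⟩
  obtain ⟨q, rfl⟩ : ∃ z : ℤ_[p], (z : ℚ_[p]) = q := ⟨⟨q, hq⟩, rfl⟩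
  obtain ⟨r, rfl⟩ : ∃ z : ℤ_[p], (z : ℚ_[p]) = r := ⟨⟨r, hr⟩, rfl⟩
  have : (Smat p (a : ℚ_[p]) b c *
      ((p : ℚ_[p]) ^ (l : ℤ) • !![(n : ℚ_[p]), (q : ℚ_[p]); q, r])).trace =
      (((p : ℤ_[p]) ^ l * (a * n + b * q + c * r) : ℤ_[p]) : ℚ_[p]) := by
    simp [Smat, trace_fin_two]
    ring
  rw [this]
  exact PadicInt.norm_le_one _

variable (p a c)

theorem bessel_values_m_zero
    (ha : ‖a‖ = 1) (hb : ‖b‖ ≤ 1) (hc : ‖c‖ = 1)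
    (hd : ‖b ^ 2 - 4 * a * c‖ = 1)
    (hnsq : ∀ z : ℚ_[p], z ^ 2 ≠ b ^ 2 - 4 * a * c)
    (B : Matrix (Fin 4) (Fin 4) ℚ_[p] → ℂ) (ψ : ℚ_[p] → ℂ)
    (Λ : Matrix (Fin 2) (Fin 2) ℚ_[p] → ℂ)
    (hψadd : ∀ x y : ℚ_[p], ψ (x + y) = ψ x * ψ y)
    (hψtriv : ∀ x : ℚ_[p], ‖x‖ ≤ 1 → ψ x = 1)
    (hψnontriv : ∃ x : ℚ_[p], ‖x‖ ≤ p ∧ ψ x ≠ 1)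
    (hΛmul : ∀ s t, s ∈ Tgrp p a b c → t ∈ Tgrp p a b c → Λ (s * t) = Λ s * Λ t)
    (hΛne : ∀ t ∈ Tgrp p a b c, Λ t ≠ 0)
    (hΛscalar : ∀ z : ℚ_[p], z ≠ 0 → Λ (z • (1 : Matrix (Fin 2) (Fin 2) ℚ_[p])) = 1)
    (hΛtriv : ∀ x y : ℚ_[p], ‖x‖ ≤ 1 → ‖y‖ < 1 →
      (x • (1 : Matrix (Fin 2) (Fin 2) ℚ_[p]) + y • xiS p a b c) ∈ GL2Z p →
      Λ (x • (1 : Matrix (Fin 2) (Fin 2) ℚ_[p]) + y • xiS p a b c) = 1)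
    (hBessel : ∀ t ∈ Tgrp p a b c, ∀ X : Matrix (Fin 2) (Fin 2) ℚ_[p], Xᵀ = X →
      ∀ g : Matrix (Fin 4) (Fin 4) ℚ_[p], ∀ k ∈ Ip p,
      B (emb p t * blk p 1 X 0 1 * g * k) = Λ t * ψ ((Smat p a b c * X).trace) * B g)
    (hB1 : B 1 = 1) (w : ℂ) (hw : w = 1 ∨ w = -1)
    (hHZ : ∀ g : Matrix (Fin 4) (Fin 4) ℚ_[p], ∑ v : Option (Fin p), B (g * ZV p v) = 0)
    (hHeta : ∀ g : Matrix (Fin 4) (Fin 4) ℚ_[p], B (g * etamat p) = w * B g)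
    (hHR : ∀ g : Matrix (Fin 4) (Fin 4) ℚ_[p], ∑ v : Option (Fin p), B (g * RV p v) = 0) :
    ∀ l : ℕ, ∀ M : ℂ,
      M = (-(p : ℂ) * w) ^ l * (p : ℂ) ^ (-(4 * (l : ℤ))) →
      B (hmat p (l : ℤ) 0 * t1 p) = -M / p ∧
      B (hmat p (l : ℤ) 0 * t2 p) = M / (p : ℂ) ^ 2 ∧
      B (hmat p (l : ℤ) 0 * t5 p) = M ∧
      B (hmat p (l : ℤ) 0 * t7 p) =
        -M * Λ ((b / 2) • (1 : Matrix (Fin 2) (Fin 2) ℚ_[p]) + xiS p a b c) / (p : ℂ) ^ 3 := by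
  have hp : (p : ℂ) ≠ 0 := by exact_mod_cast (Fact.out : p.Prime).ne_zero
  have hpQ : (p : ℚ_[p]) ≠ 0 := by exact_mod_cast (Fact.out : p.Prime).ne_zero
  have ha0 : a ≠ 0 := norm_ne_zero_iff.mp (by rw [ha]; exact one_ne_zero)
  have hc0 : c ≠ 0 := norm_ne_zero_iff.mp (by rw [hc]; exact one_ne_zero)
  have hψ0 : ψ 0 = 1 := hψtriv 0 (by simp)
  have hblk : blk p 1 0 0 1 = 1 := by simp [blk]
  have hT : ∀ t ∈ Tgrp p a b c, ∀ g, B (emb p t * g) = Λ t * B g := by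
    intro t ht g
    have h := hBessel t ht 0 (by simp) g 1 one_mem_Ip
    simpa [hblk, hψ0] using h
  have hemb : emb p (1 : Matrix (Fin 2) (Fin 2) ℚ_[p]) = 1 := by
    simpa using emb_smul_one (p := p) one_ne_zero
  have hone : (1 : Matrix (Fin 2) (Fin 2) ℚ_[p]) ∈ Tgrp p a b c := by
    simpa using smul_one_mem_Tgrp (p := p) a b c one_ne_zero
  have hΛ1 : Λ 1 = 1 := by simpa using hΛscalar 1 one_ne_zero
  have hK : ∀ g, ∀ k ∈ Ip p, B (g * k) = B g := by
    intro g k hk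
    simpa [hblk, hψ0, hemb, hΛ1] using hBessel 1 hone 0 (by simp) g k hk
  have hU : ∀ l : ℕ, ∀ n q r : ℚ_[p], ‖n‖ ≤ 1 → ‖q‖ ≤ 1 → ‖r‖ ≤ 1 → ∀ x,
      B (hmat p l 0 * (Umat p n q r * x)) = B (hmat p l 0 * x) := by
    intro l n q r hn hq hr x
    have hsymm : ((p : ℚ_[p]) ^ (l : ℤ) • !![n, q; q, r])ᵀ =
        (p : ℚ_[p]) ^ (l : ℤ) • !![n, q; q, r] := by
      ext i j
      fin_cases i <;> fin_cases j <;> rfl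
    have h := hBessel 1 hone _ hsymm (hmat p l 0 * x) 1 one_mem_Ip
    rw [hψtriv _ (norm_trace_Smat_mul_le b l ha.le hb hc.le hn hq hr), hΛ1, hemb] at h
    rw [← mul_assoc, hmat_mul_Umat, mul_assoc]
    simpa using h
  have hcentral : ∀ g, B ((p : ℚ_[p]) • g) = B g := by
    intro g
    have h := hT _ (smul_one_mem_Tgrp (p := p) a b c hpQ) g
    rwa [emb_smul_one hpQ, hΛscalar _ hpQ, one_mul, smul_mul_assoc, one_mul] at h
  have hweyl := fun l : ℕ ↦ hecke_values_of_weyl_word hK hHZ hHR (hU l)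
  have hww : w * w = 1 := by rcases hw with rfl | rfl <;> norm_num
  have hrec : ∀ l : ℕ, B (hmat p (l + 1 : ℕ) 0) = -w * B (hmat p l 0) / p ^ 3 := by
    intro l
    have h := hHeta (hmat p (l + 1 : ℕ) 0)
    rw [hmat_succ_mul_etamat, hcentral, hK _ _ (diagonal_mem_Ip (by simp) (by simp) (by simp)
      (by simp) (by simp)), (hweyl l).2.2] at h
    linear_combination (-w) * h - B (hmat p (l + 1 : ℕ) 0) * hww
  have hval : ∀ l : ℕ,
      B (hmat p l 0) = (-(p : ℂ) * w) ^ l * (p : ℂ) ^ (-(4 * (l : ℤ))) := by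
    intro l
    induction l with
    | zero =>
      have : hmat p ((0 : ℕ) : ℤ) 0 = 1 := by
        ext i j
        fin_cases i <;> fin_cases j <;> simp [hmat]
      rw [this, hB1]
      simp
    | succ l ih =>
      have hexp : (p : ℂ) ^ (-(4 * ((l + 1 : ℕ) : ℤ))) = (p : ℂ) ^ (-(4 * (l : ℤ))) / p ^ 4 := by
        rw [show -(4 * ((l + 1 : ℕ) : ℤ)) = -(4 * (l : ℤ)) - (4 : ℕ) by push_cast; ring,
          zpow_sub₀ hp, zpow_natCast]
      rw [hrec, ih, hexp]
      field_simp
      ring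
  intro l M hM
  rw [← hval] at hM
  subst hM
  obtain ⟨h1, h2, h3⟩ := hweyl l
  refine ⟨?_, ?_, ?_, ?_⟩
  · rw [t1_eq, hU l _ _ _ (by simp) (by simp) (by simp), ← mul_assoc, hK _ _ iwahori_t1, h1]
  · rw [t2_eq, hU l _ _ _ (by simp) (by simp) (by simp), ← mul_assoc, hK _ _ iwahori_t2,
      ← mul_assoc, h2]
  · rw [t5_eq, hK _ _ (diagonal_mem_Ip (by simp) (by simp) (by simp) (by simp) rfl)]
  · rw [t7_eq, ← emb_torus_generator_mul b ha0 hc0, ← mul_assoc,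
      hK _ _ (iwahori_torus_generator b ha hb hc), ← mul_assoc,
      hmat_mul_emb _ (by simp [ha0, hc0]), mul_assoc, hT _ (torus_generator_mem_Tgrp b ha0 hc0),
      Jmat_mul_Zinf_eq, ← mul_assoc,
      hK _ _ (diagonal_mem_Ip (by simp) (by simp) (by simp) (by simp) (by simp)), ← mul_assoc,
      ← mul_assoc, h3, half_smul_one_add_xiS]
    ring
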